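/- arXiv:2208.08978 — 3 statements merged into one kernel-verified Lean document; each statement's English description precedes it below -/
import Mathlib

section
/- Let a < b be real numbers, let ℓ ≥ 1 be a natural number, and let p be a real polynomial of degree at most ℓ such that p(a) = 0, p(b) = 0, and ∫_a^b p(x) q(x) dx = 0 for every real polynomial q of degree at most ℓ − 2 (no integral condition when ℓ = 1). Then p = 0. -/
open Polynomial intervalIntegral

theorem Polynomial.exists_eq_mul_of_eval_eq_zero_of_ne {K : Type*} [Field K] {p : K[X]} {a b : K}
    (hab : a ≠ b) (ha : p.eval a = 0) (hb : p.eval b = 0) :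
    ∃ q : K[X], p = (X - C a) * (X - C b) * q :=
  (isCoprime_X_sub_C_of_isUnit_sub (sub_ne_zero.mpr hab).isUnit).mul_dvd
    (dvd_iff_isRoot.mpr ha) (dvd_iff_isRoot.mpr hb)

theorem Polynomial.exists_mem_Ioo_eval_ne_zero {q : ℝ[X]} (hq : q ≠ 0) {a b : ℝ} (hab : a < b) :
    ∃ c ∈ Set.Ioo a b, q.eval c ≠ 0 := by
  by_contra! h
  exact hq (q.eq_zero_of_infinite_isRoot ((Set.Ioo_infinite hab).mono h))

theorem Polynomial.integral_bubble_mul_sq_pos {q : ℝ[X]} (hq : q ≠ 0) {a b : ℝ} (hab : a < b) :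
    0 < ∫ x in a..b, (x - a) * (b - x) * q.eval x ^ 2 := by
  obtain ⟨c, hc, hqc⟩ := exists_mem_Ioo_eval_ne_zero hq hab
  refine integral_pos hab (by fun_prop) (fun x hx => ?_) ⟨c, Set.Ioo_subset_Icc_self hc, ?_⟩
  · exact mul_nonneg (mul_nonneg (sub_nonneg.mpr hx.1.le) (sub_nonneg.mpr hx.2)) (sq_nonneg _)
  · exact mul_pos (mul_pos (sub_pos.mpr hc.1) (sub_pos.mpr hc.2)) (sq_pos_of_ne_zero hqc)

theorem h1_conforming_edge_unisolvency
    (a b : ℝ) (hab : a < b) (ℓ : ℕ) (hℓ : 1 ≤ ℓ)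
    (p : Polynomial ℝ) (hdeg : p.natDegree ≤ ℓ)
    (ha : p.eval a = 0) (hb : p.eval b = 0)
    (hint : ∀ q : Polynomial ℝ, q.degree + 2 ≤ (ℓ : WithBot ℕ) →
      (∫ x in a..b, p.eval x * q.eval x) = 0) :
    p = 0 := by
  obtain ⟨q, rfl⟩ := exists_eq_mul_of_eval_eq_zero_of_ne hab.ne ha hb
  by_contra hp
  have hq : q ≠ 0 := right_ne_zero_of_mul hp
  have hdeg_q : q.degree + 2 ≤ (ℓ : WithBot ℕ) := by
    have h := natDegree_le_iff_degree_le.mp hdeg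
    rwa [degree_mul, degree_mul, degree_X_sub_C, degree_X_sub_C, one_add_one_eq_two,
      add_comm] at h
  have hpos := integral_bubble_mul_sq_pos hq hab
  have hneg : (∫ x in a..b, (x - a) * (b - x) * q.eval x ^ 2) =
      -∫ x in a..b, ((X - C a) * (X - C b) * q).eval x * q.eval x := by
    rw [← intervalIntegral.integral_neg]
    congr 1 with x
    simp only [eval_mul, eval_sub, eval_X, eval_C]
    ring
  rw [hneg, hint q hdeg_q, neg_zero] at hpos
  exact hpos.false
end

section
/- Let a < b be real numbers, let ℓ ≥ 3 be a natural number, and let p be a real polynomial of degree at most ℓ such that p(a) = 0, p(b) = 0, p′(a) = 0, p′(b) = 0, and ∫_a^b p(x) q(x) dx = 0 for every real polynomial q of degree at most ℓ − 4 (no integral condition when ℓ = 3). Then p = 0. -/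
open Polynomial intervalIntegral

/-- A common zero of a polynomial and its derivative is a double root. -/
theorem Polynomial.X_sub_C_sq_dvd_of_eval_eq_zero {R : Type*} [CommRing R] {p : R[X]} {a : R}
    (h : p.eval a = 0) (h' : p.derivative.eval a = 0) : (X - C a) ^ 2 ∣ p := by
  obtain ⟨s, rfl⟩ := dvd_iff_isRoot.mpr h
  have hs : s.eval a = 0 := by simpa [derivative_mul] using h'
  rw [sq]
  exact mul_dvd_mul_left _ (dvd_iff_isRoot.mpr hs)

/-- A real polynomial whose square integrates to zero over a nontrivial interval vanishes. -/
theorem Polynomial.eq_zero_of_integral_sq_eq_zero {a b : ℝ} (hab : a < b) {r : ℝ[X]}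
    (h : ∫ x in a..b, r.eval x ^ 2 = 0) : r = 0 := by
  refine eq_zero_of_infinite_isRoot r ((Set.Icc_infinite hab).mono fun c hc => ?_)
  by_contra hne
  have hpos : 0 < ∫ x in a..b, r.eval x ^ 2 :=
    integral_pos hab (by fun_prop) (fun x _ => sq_nonneg _) ⟨c, hc, sq_pos_of_ne_zero hne⟩
  exact hpos.ne' h

theorem h2_conforming_edge_unisolvency
    (a b : ℝ) (hab : a < b) (ℓ : ℕ) (hℓ : 3 ≤ ℓ)
    (p : Polynomial ℝ) (hdeg : p.natDegree ≤ ℓ)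
    (ha : p.eval a = 0) (hb : p.eval b = 0)
    (ha' : p.derivative.eval a = 0) (hb' : p.derivative.eval b = 0)
    (hint : ∀ q : Polynomial ℝ, q.degree + 4 ≤ (ℓ : WithBot ℕ) →
      (∫ x in a..b, p.eval x * q.eval x) = 0) :
    p = 0 := by
  have hcop : IsCoprime ((X - C a) ^ 2) ((X - C b) ^ 2) :=
    (isCoprime_X_sub_C_of_isUnit_sub (sub_ne_zero.mpr hab.ne).isUnit).pow
  obtain ⟨q, rfl⟩ := hcop.mul_dvd (X_sub_C_sq_dvd_of_eval_eq_zero ha ha')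
    (X_sub_C_sq_dvd_of_eval_eq_zero hb hb')
  have hq : q.degree + 4 ≤ (ℓ : WithBot ℕ) := by
    have h := natDegree_le_iff_degree_le.mp hdeg
    rw [degree_mul, degree_mul, degree_pow, degree_pow, degree_X_sub_C, degree_X_sub_C,
      add_comm] at h
    exact h
  have hr : (X - C a) * (X - C b) * q = 0 := by
    refine eq_zero_of_integral_sq_eq_zero hab ?_
    rw [← hint q hq]
    congr 1 with x
    simp only [eval_mul, eval_pow]
    ring
  linear_combination (X - C a) * (X - C b) * hr
end

section
/- Let a < b be real numbers and let ℓ ≥ 2 be a natural number. For every v_a, v_b ∈ ℝ and every function g : ℕ → ℝ, there exists a unique real polynomial p of degree at most ℓ − 1 such that p(a) = v_a, p(b) = v_b, and ∫_a^b p(x) x^j dx = g(j) for every natural number j with j < ℓ − 2 (no integral conditions when ℓ = 2). -/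
open Polynomial intervalIntegral

/-- The moment functional `p ↦ ∫ x in a..b, p(x) * r(x)`. -/
noncomputable def polynomialMoment (a b : ℝ) (r : ℝ[X]) : ℝ[X] →ₗ[ℝ] ℝ where
  toFun p := ∫ x in a..b, p.eval x * r.eval x
  map_add' p q := by
    simp only [eval_add, add_mul]
    exact integral_add (Continuous.intervalIntegrable (by fun_prop) _ _)
      (Continuous.intervalIntegrable (by fun_prop) _ _)
  map_smul' c p := by
    simp [mul_assoc]

theorem polynomialMoment_comm (a b : ℝ) (p r : ℝ[X]) :
    polynomialMoment a b r p = polynomialMoment a b p r := by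
  simp [polynomialMoment, mul_comm]

/-- A polynomial orthogonal to all monomials of degree less than `n` is orthogonal to all
polynomials of degree less than `n`. -/
theorem polynomialMoment_eq_zero_of_degree_lt {a b : ℝ} {p q : ℝ[X]} {n : ℕ}
    (hp : ∀ j < n, polynomialMoment a b (X ^ j) p = 0) (hq : q.degree < n) :
    polynomialMoment a b q p = 0 := by
  classical
  rw [polynomialMoment_comm]
  have hle : degreeLT ℝ n ≤ LinearMap.ker (polynomialMoment a b p) := by
    rw [degreeLT_eq_span_X_pow, Submodule.span_le]
    intro r hr
    obtain ⟨j, hj, rfl⟩ := Finset.mem_image.mp hr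
    rw [SetLike.mem_coe, LinearMap.mem_ker, ← polynomialMoment_comm]
    exact hp j (Finset.mem_range.mp hj)
  exact LinearMap.mem_ker.mp (hle (mem_degreeLT.mpr hq))

/-- If the weighted square `(x - a) (x - b) q(x) ^ 2` has zero integral over `[a, b]`,
then `q = 0`. -/
theorem eq_zero_of_polynomialMoment_mul_self_eq_zero {a b : ℝ} (hab : a < b) {q : ℝ[X]}
    (h : polynomialMoment a b q ((X - C a) * (X - C b) * q) = 0) : q = 0 := by
  by_contra hq
  obtain ⟨c, hc, hqc⟩ : ∃ c ∈ Set.Ioo a b, q.eval c ≠ 0 := by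
    by_contra! hroots
    exact hq (eq_zero_of_infinite_isRoot q ((Set.Ioo_infinite hab).mono hroots))
  have hpos : 0 < ∫ x in a..b, (x - a) * (b - x) * q.eval x ^ 2 := by
    refine integral_pos hab (by fun_prop) (fun x hx => ?_) ⟨c, Set.Ioo_subset_Icc_self hc, ?_⟩
    · have := sub_nonneg.mpr hx.1.le
      have := sub_nonneg.mpr hx.2
      positivity
    · have := sub_pos.mpr hc.1
      have := sub_pos.mpr hc.2
      positivity
  have hneg : polynomialMoment a b q ((X - C a) * (X - C b) * q) =
      -∫ x in a..b, (x - a) * (b - x) * q.eval x ^ 2 := by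
    rw [← intervalIntegral.integral_neg]
    refine integral_congr fun x _ => ?_
    simp only [eval_mul, eval_sub, eval_X, eval_C]
    ring
  linarith

/-- A polynomial of degree less than `n + 2` vanishing at `a` and `b`, whose first `n` moments
on `[a, b]` vanish, is zero. -/
theorem eq_zero_of_eval_eq_zero_of_polynomialMoment_eq_zero {a b : ℝ} (hab : a < b) {n : ℕ}
    {p : ℝ[X]} (hdeg : p.degree < (n + 2 : ℕ)) (ha : p.eval a = 0) (hb : p.eval b = 0)
    (hp : ∀ j < n, polynomialMoment a b (X ^ j) p = 0) : p = 0 := by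
  obtain ⟨q, rfl⟩ : (X - C a) * (X - C b) ∣ p :=
    (isCoprime_X_sub_C_of_isUnit_sub (sub_ne_zero.mpr hab.ne).isUnit).mul_dvd
      (dvd_iff_isRoot.mpr ha) (dvd_iff_isRoot.mpr hb)
  suffices q = 0 by simp [this]
  by_contra hq
  refine hq (eq_zero_of_polynomialMoment_mul_self_eq_zero hab
    (polynomialMoment_eq_zero_of_degree_lt hp ?_))
  rw [degree_mul, degree_mul, degree_X_sub_C, degree_X_sub_C, degree_eq_natDegree hq] at hdeg
  rw [degree_eq_natDegree hq]
  norm_cast at hdeg ⊢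
  omega

/-- The endpoint values and the first `n` moments on `[a, b]`. -/
noncomputable def endpointMoments (a b : ℝ) (n : ℕ) : ℝ[X] →ₗ[ℝ] ℝ × ℝ × (Fin n → ℝ) :=
  (leval a).prod ((leval b).prod (LinearMap.pi fun j => polynomialMoment a b (X ^ (j : ℕ))))

theorem endpointMoments_domRestrict_bijective {a b : ℝ} (hab : a < b) (n : ℕ) :
    Function.Bijective ((endpointMoments a b n).domRestrict (degreeLT ℝ (n + 2))) := by
  set T := (endpointMoments a b n).domRestrict (degreeLT ℝ (n + 2))
  have hinj : Function.Injective T := by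
    rw [injective_iff_map_eq_zero]
    rintro ⟨p, hp⟩ h
    have h' : p.eval a = 0 ∧ p.eval b = 0 ∧
        (fun j : Fin n => polynomialMoment a b (X ^ (j : ℕ)) p) = 0 :=
      ⟨congrArg Prod.fst h, congrArg (fun y => y.2.1) h, congrArg (fun y => y.2.2) h⟩
    exact Subtype.ext (eq_zero_of_eval_eq_zero_of_polynomialMoment_eq_zero hab
      (mem_degreeLT.mp hp) h'.1 h'.2.1 fun j hj => congrFun h'.2.2 ⟨j, hj⟩)
  have : FiniteDimensional ℝ (degreeLT ℝ (n + 2)) :=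
    (degreeLTEquiv ℝ (n + 2)).symm.finiteDimensional
  refine ⟨hinj, (LinearMap.injective_iff_surjective_of_finrank_eq_finrank ?_).mp hinj⟩
  rw [(degreeLTEquiv ℝ (n + 2)).finrank_eq]
  simp
  omega

theorem h2_conforming_edge_normal_projection_wellposed
    (a b : ℝ) (hab : a < b) (ℓ : ℕ) (hℓ : 2 ≤ ℓ)
    (va vb : ℝ) (g : ℕ → ℝ) :
    ∃! p : Polynomial ℝ, p.natDegree ≤ ℓ - 1 ∧ p.eval a = va ∧ p.eval b = vb ∧
      ∀ j : ℕ, j < ℓ - 2 → (∫ x in a..b, p.eval x * x ^ j) = g j := by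
  obtain ⟨n, rfl⟩ := Nat.exists_eq_add_of_le' hℓ
  have hmem (p : ℝ[X]) : p.natDegree ≤ n + 2 - 1 ↔ p ∈ degreeLT ℝ (n + 2) := by
    rw [natDegree_le_iff_coeff_eq_zero, mem_degreeLT, degree_lt_iff_coeff_zero]
    rfl
  have hval (p : ℝ[X]) : (p.eval a = va ∧ p.eval b = vb ∧
      ∀ j : ℕ, j < n + 2 - 2 → (∫ x in a..b, p.eval x * x ^ j) = g j) ↔
      endpointMoments a b n p = (va, vb, fun j : Fin n => g j) := by
    simp [endpointMoments, polynomialMoment, Prod.ext_iff, funext_iff, Fin.forall_iff]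
  simp only [hmem, hval]
  obtain ⟨⟨p, hp⟩, hpv, huniq⟩ :=
    (endpointMoments_domRestrict_bijective hab n).existsUnique (va, vb, fun j : Fin n => g j)
  exact ⟨p, ⟨hp, hpv⟩, fun q hq => congrArg Subtype.val (huniq ⟨q, hq.1⟩ hq.2)⟩
end
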